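/- Let l ∈ {1, 2} and ρ > 0. Define g_{l+}(r) = D_l( exp(e^{i 5π/8} ρ r) - exp(e^{i 9π/8} ρ r) ), where D_l is the differential operation (D_l w)(r) = r^{l+1} ((1/r) d/dr)^l (w(r)/r). Then g_{l+} is square integrable on (0,∞) and satisfies (T_l^2 g_{l+})(r) = i ρ^4 g_{l+}(r) for all r > 0, where T_l^2 is the fourth-order differential operation obtained by applying (T_l u)(r) = -u''(r) + l(l+1)u(r)/r^2 twice. -/

import Mathlib

open Set MeasureTheory

/-- The `l`-th order differential operation
`(D_l w)(r) = r^(l+1) ((1/r) d/dr)^l (w(r)/r)` on `(0,∞)`. -/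
noncomputable def Dop (l : ℕ) (w : ℝ → ℂ) : ℝ → ℂ :=
  fun r => (r : ℂ) ^ (l + 1) *
    ((fun f : ℝ → ℂ => fun s : ℝ => ((s : ℂ))⁻¹ * deriv f s)^[l]
      (fun s : ℝ => w s / (s : ℂ))) r

/-- The second-order differential operation
`(T_l u)(r) = -u''(r) + l(l+1) u(r)/r^2` on `(0,∞)`. -/
noncomputable def Tl (l : ℕ) (u : ℝ → ℂ) : ℝ → ℂ :=
  fun r => -(deriv (deriv u) r) + ((l : ℂ) * ((l : ℂ) + 1)) * u r / (r : ℂ) ^ 2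

/-- The deficiency element
`g_{l+} = D_l(exp(e^{i5π/8} ρ r) - exp(e^{i9π/8} ρ r))`. -/
noncomputable def gPlus (l : ℕ) (ρ : ℝ) : ℝ → ℂ :=
  Dop l (fun r =>
    Complex.exp (Complex.exp (Complex.I * (5 * Real.pi / 8)) * ρ * r)
      - Complex.exp (Complex.exp (Complex.I * (9 * Real.pi / 8)) * ρ * r))

/-- An exponential times a polynomial in `1/r`. -/
noncomputable def expLaurent (c₀ c₁ c₂ c₃ a : ℂ) (r : ℝ) : ℂ :=
  (c₀ + c₁ / r + c₂ / (r : ℂ) ^ 2 + c₃ / (r : ℂ) ^ 3) * Complex.exp (a * r)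

lemma hasDerivAt_expLaurent (c₀ c₁ c₂ c₃ a : ℂ) {r : ℝ} (hr : r ≠ 0) :
    HasDerivAt (expLaurent c₀ c₁ c₂ c₃ a)
      ((a * c₀ + a * c₁ / r + (a * c₂ - c₁) / (r : ℂ) ^ 2 + (a * c₃ - 2 * c₂) / (r : ℂ) ^ 3
        - 3 * c₃ / (r : ℂ) ^ 4) * Complex.exp (a * r)) r := by
  have hc : (r : ℂ) ≠ 0 := by exact_mod_cast hr
  have hid : HasDerivAt (fun z : ℂ => z) 1 (r : ℂ) := hasDerivAt_id _
  have h1 := (hasDerivAt_const (r : ℂ) c₁).div hid hc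
  have h2 := (hasDerivAt_const (r : ℂ) c₂).div (hid.pow 2) (pow_ne_zero 2 hc)
  have h3 := (hasDerivAt_const (r : ℂ) c₃).div (hid.pow 3) (pow_ne_zero 3 hc)
  have he := (hid.const_mul a).cexp
  have h := (((((hasDerivAt_const (r : ℂ) c₀).add h1).add h2).add h3).mul he).comp_ofReal
  refine h.congr_deriv ?_
  simp only [Pi.add_apply, Pi.div_apply, Pi.pow_apply]
  field_simp
  push_cast
  ring

/-- The values on `(0,∞)` determine the derivative there. -/
lemma deriv_eq_of_eqOn_Ioi {f g : ℝ → ℂ} (h : EqOn f g (Ioi 0)) {r : ℝ} (hr : 0 < r) {d : ℂ}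
    (hg : HasDerivAt g d r) : deriv f r = d :=
  (hg.congr_of_eventuallyEq (h.eventuallyEq_of_mem (Ioi_mem_nhds hr))).deriv

/-- The relations between `c₀, c₁, c₂` under which `(c₀ + c₁ / r + c₂ / r ^ 2) exp (a r)`
is an eigenfunction of `T_l` with eigenvalue `-a ^ 2`. -/
def IsEigenCoeff (l : ℕ) (a c₀ c₁ c₂ : ℂ) : Prop :=
  2 * a * c₁ + l * (l + 1) * c₀ = 0 ∧ 4 * a * c₂ - 2 * c₁ + l * (l + 1) * c₁ = 0 ∧
    l * (l + 1) * c₂ = 6 * c₂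

lemma Tl_eqOn {l : ℕ} {a b c₀ c₁ c₂ d₀ d₁ d₂ A B : ℂ} (hc : IsEigenCoeff l a c₀ c₁ c₂)
    (hd : IsEigenCoeff l b d₀ d₁ d₂) {f : ℝ → ℂ}
    (hf : EqOn f (fun r => A * expLaurent c₀ c₁ c₂ 0 a r + B * expLaurent d₀ d₁ d₂ 0 b r)
      (Ioi 0)) :
    EqOn (Tl l f) (fun r => -a ^ 2 * A * expLaurent c₀ c₁ c₂ 0 a r
      + -b ^ 2 * B * expLaurent d₀ d₁ d₂ 0 b r) (Ioi 0) := by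
  have hf' : EqOn (deriv f) (fun r =>
      A * expLaurent (a * c₀) (a * c₁) (a * c₂ - c₁) (-2 * c₂) a r
      + B * expLaurent (b * d₀) (b * d₁) (b * d₂ - d₁) (-2 * d₂) b r) (Ioi 0) := by
    intro r hr
    refine deriv_eq_of_eqOn_Ioi hf hr ((((hasDerivAt_expLaurent c₀ c₁ c₂ 0 a
      (ne_of_gt hr)).const_mul A).add ((hasDerivAt_expLaurent d₀ d₁ d₂ 0 b
      (ne_of_gt hr)).const_mul B)).congr_deriv ?_)
    simp only [expLaurent]
    ring
  intro r hr
  have hr0 : (r : ℂ) ≠ 0 := by exact_mod_cast (ne_of_gt hr)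
  have h2 := deriv_eq_of_eqOn_Ioi hf' hr
    (((hasDerivAt_expLaurent (a * c₀) (a * c₁) (a * c₂ - c₁) (-2 * c₂) a
      (ne_of_gt hr)).const_mul A).add ((hasDerivAt_expLaurent (b * d₀) (b * d₁) (b * d₂ - d₁)
      (-2 * d₂) b (ne_of_gt hr)).const_mul B))
  obtain ⟨hc0, hc1, hc2⟩ := hc
  obtain ⟨hd0, hd1, hd2⟩ := hd
  rw [Tl, h2, hf hr]
  simp only [expLaurent]
  linear_combination
    A * Complex.exp (a * r) * (hc0 / (r : ℂ) ^ 2 + hc1 / (r : ℂ) ^ 3 + hc2 / (r : ℂ) ^ 4)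
    + B * Complex.exp (b * r) * (hd0 / (r : ℂ) ^ 2 + hd1 / (r : ℂ) ^ 3 + hd2 / (r : ℂ) ^ 4)

lemma Dop_one_eqOn (a b : ℂ) :
    EqOn (Dop 1 fun r => Complex.exp (a * r) - Complex.exp (b * r))
      (fun r => expLaurent a (-1) 0 0 a r - expLaurent b (-1) 0 0 b r) (Ioi 0) := by
  intro r hr
  have hr0 : (r : ℂ) ≠ 0 := by exact_mod_cast (ne_of_gt hr)
  have h : EqOn (fun s : ℝ => (Complex.exp (a * s) - Complex.exp (b * s)) / (s : ℂ))
      (fun s => expLaurent 0 1 0 0 a s - expLaurent 0 1 0 0 b s) (Ioi 0) := by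
    intro s _
    simp only [expLaurent]
    ring
  have hd := deriv_eq_of_eqOn_Ioi h hr ((hasDerivAt_expLaurent 0 1 0 0 a (ne_of_gt hr)).sub
    (hasDerivAt_expLaurent 0 1 0 0 b (ne_of_gt hr)))
  simp only [Dop, Function.iterate_one, hd, expLaurent]
  field_simp
  ring

lemma Dop_two_eqOn (a b : ℂ) :
    EqOn (Dop 2 fun r => Complex.exp (a * r) - Complex.exp (b * r))
      (fun r => expLaurent (a ^ 2) (-3 * a) 3 0 a r - expLaurent (b ^ 2) (-3 * b) 3 0 b r)
      (Ioi 0) := by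
  intro r hr
  have hr0 : (r : ℂ) ≠ 0 := by exact_mod_cast (ne_of_gt hr)
  have h : EqOn (fun s : ℝ => (Complex.exp (a * s) - Complex.exp (b * s)) / (s : ℂ))
      (fun s => expLaurent 0 1 0 0 a s - expLaurent 0 1 0 0 b s) (Ioi 0) := by
    intro s _
    simp only [expLaurent]
    ring
  have h' : EqOn (fun s : ℝ => (s : ℂ)⁻¹ * deriv
      (fun s : ℝ => (Complex.exp (a * s) - Complex.exp (b * s)) / (s : ℂ)) s)
      (fun s => expLaurent 0 0 a (-1) a s - expLaurent 0 0 b (-1) b s) (Ioi 0) := by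
    intro s hs
    have hs0 : (s : ℂ) ≠ 0 := by exact_mod_cast (ne_of_gt hs)
    have hd := deriv_eq_of_eqOn_Ioi h hs ((hasDerivAt_expLaurent 0 1 0 0 a (ne_of_gt hs)).sub
      (hasDerivAt_expLaurent 0 1 0 0 b (ne_of_gt hs)))
    simp only [hd, expLaurent]
    field_simp
    ring
  have hd := deriv_eq_of_eqOn_Ioi h' hr ((hasDerivAt_expLaurent 0 0 a (-1) a (ne_of_gt hr)).sub
    (hasDerivAt_expLaurent 0 0 b (-1) b (ne_of_gt hr)))
  simp only [Dop, Function.iterate_succ, Function.iterate_zero, Function.comp_apply, id_eq, hd,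
    expLaurent]
  field_simp
  ring

lemma norm_exp_mul_le (a : ℂ) {r : ℝ} (hr : r ∈ Ioc (0 : ℝ) 1) :
    ‖Complex.exp (a * r)‖ ≤ Real.exp ‖a‖ ∧
    ‖Complex.exp (a * r) - 1‖ / r ≤ ‖a‖ * Real.exp ‖a‖ ∧
    ‖Complex.exp (a * r) - 1 - a * r‖ / r ^ 2 ≤ ‖a‖ ^ 2 * Real.exp ‖a‖ := by
  obtain ⟨h0, h1⟩ := hr
  have hx : ‖a * (r : ℂ)‖ = ‖a‖ * r := by rw [norm_mul, Complex.norm_real, Real.norm_of_nonneg h0.le]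
  have hle : Real.exp ‖a * (r : ℂ)‖ ≤ Real.exp ‖a‖ :=
    Real.exp_le_exp.2 (hx ▸ mul_le_of_le_one_right (norm_nonneg a) h1)
  have key (n : ℕ) : ‖Complex.exp (a * r) - ∑ m ∈ Finset.range n, (a * r) ^ m / m.factorial‖ ≤
      ‖a‖ ^ n * Real.exp ‖a‖ * r ^ n := by
    refine (Complex.norm_exp_sub_sum_le_norm_mul_exp _ n).trans ?_
    calc _ ≤ ‖a * (r : ℂ)‖ ^ n * Real.exp ‖a‖ := by gcongr
      _ = _ := by rw [hx]; ring
  have k0 := key 0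
  have k1 := key 1
  have k2 := key 2
  simp [Finset.sum_range_succ] at k0 k1 k2
  refine ⟨k0, (div_le_iff₀ h0).2 k1, (div_le_iff₀ (pow_pos h0 2)).2 ?_⟩
  rwa [sub_sub]

lemma norm_expLaurent_one_add_le (a : ℂ) {r : ℝ} (hr : r ∈ Ioc (0 : ℝ) 1) :
    ‖expLaurent a (-1) 0 0 a r + 1 / r‖ ≤ 2 * ‖a‖ * Real.exp ‖a‖ := by
  obtain ⟨h0, h1, -⟩ := norm_exp_mul_le a hr
  have e : expLaurent a (-1) 0 0 a r + 1 / r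
      = a * Complex.exp (a * r) - (Complex.exp (a * r) - 1) / r := by
    simp only [expLaurent]
    ring
  have hn : ‖(r : ℂ)‖ = r := by rw [Complex.norm_real, Real.norm_of_nonneg hr.1.le]
  rw [e]
  refine (norm_sub_le _ _).trans ?_
  rw [norm_mul, norm_div, hn]
  nlinarith [mul_le_mul_of_nonneg_left h0 (norm_nonneg a)]

lemma norm_expLaurent_two_sub_le (a : ℂ) {r : ℝ} (hr : r ∈ Ioc (0 : ℝ) 1) :
    ‖expLaurent (a ^ 2) (-3 * a) 3 0 a r - 3 / (r : ℂ) ^ 2‖ ≤ 7 * ‖a‖ ^ 2 * Real.exp ‖a‖ := by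
  obtain ⟨h0, h1, h2⟩ := norm_exp_mul_le a hr
  have hr0 : (r : ℂ) ≠ 0 := by exact_mod_cast hr.1.ne'
  have e : expLaurent (a ^ 2) (-3 * a) 3 0 a r - 3 / (r : ℂ) ^ 2
      = a ^ 2 * Complex.exp (a * r) - 3 * a * ((Complex.exp (a * r) - 1) / r)
        + 3 * ((Complex.exp (a * r) - 1 - a * r) / (r : ℂ) ^ 2) := by
    simp only [expLaurent]
    field_simp
    ring
  have hn : ‖(r : ℂ)‖ = r := by rw [Complex.norm_real, Real.norm_of_nonneg hr.1.le]
  rw [e]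
  refine (norm_add_le _ _).trans ((add_le_add_left (norm_sub_le _ _) _).trans ?_)
  simp only [norm_mul, norm_div, norm_pow, hn, Complex.norm_ofNat]
  nlinarith [mul_le_mul_of_nonneg_left h0 (sq_nonneg ‖a‖),
    mul_le_mul_of_nonneg_left h1 (norm_nonneg a)]

lemma continuousOn_expLaurent (c₀ c₁ c₂ c₃ a : ℂ) :
    ContinuousOn (expLaurent c₀ c₁ c₂ c₃ a) (Ioi 0) := fun _ hr =>
  (hasDerivAt_expLaurent c₀ c₁ c₂ c₃ a (ne_of_gt hr)).continuousAt.continuousWithinAt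

lemma integrableOn_sq_norm_expLaurent (c₀ c₁ c₂ : ℂ) {a : ℂ} (ha : a.re < 0) :
    IntegrableOn (fun r => ‖expLaurent c₀ c₁ c₂ 0 a r‖ ^ 2) (Ioi 1) := by
  have hi : IntegrableOn (fun r : ℝ => (‖c₀‖ + ‖c₁‖ + ‖c₂‖) ^ 2 * Real.exp (2 * a.re * r))
      (Ioi 1) := (integrableOn_exp_mul_Ioi (by linarith) 1).const_mul _
  refine hi.mono' ?_ ?_
  · exact (((continuousOn_expLaurent c₀ c₁ c₂ 0 a).mono
      (Ioi_subset_Ioi zero_le_one)).norm.pow 2).aestronglyMeasurable measurableSet_Ioi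
  · refine (ae_restrict_iff' measurableSet_Ioi).2 (Filter.Eventually.of_forall fun r hr => ?_)
    have hr1 : (1 : ℝ) ≤ r := le_of_lt hr
    have hn : ‖(r : ℂ)‖ = r := by rw [Complex.norm_real, Real.norm_of_nonneg (by linarith)]
    have he : Real.exp (2 * a.re * r) = Real.exp (a.re * r) ^ 2 := by
      rw [← Real.exp_nat_mul]
      congr 1
      push_cast
      ring
    rw [Real.norm_of_nonneg (by positivity), he, ← mul_pow]
    have hE : ‖Complex.exp (a * r)‖ = Real.exp (a.re * r) := by simp [Complex.norm_exp]
    simp only [expLaurent, norm_mul, hE, zero_div, add_zero]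
    gcongr
    refine norm_add₃_le.trans ?_
    rw [norm_div, norm_div, norm_pow, hn]
    gcongr
    · exact div_le_self (norm_nonneg _) hr1
    · exact div_le_self (norm_nonneg _) (one_le_pow₀ hr1)

lemma integrableOn_sq_norm_sub {c₀ c₁ c₂ d₀ d₁ d₂ a b : ℂ} {g : ℝ → ℂ} {C : ℝ}
    (hg : EqOn g (fun r => expLaurent c₀ c₁ c₂ 0 a r - expLaurent d₀ d₁ d₂ 0 b r) (Ioi 0))
    (ha : a.re < 0) (hb : b.re < 0) (hC : ∀ r ∈ Ioc (0 : ℝ) 1, ‖g r‖ ≤ C) :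
    IntegrableOn (fun r => ‖g r‖ ^ 2) (Ioi 0) := by
  have hcont : ContinuousOn (fun r => ‖g r‖ ^ 2) (Ioi 0) :=
    ((((continuousOn_expLaurent c₀ c₁ c₂ 0 a).sub
      (continuousOn_expLaurent d₀ d₁ d₂ 0 b)).congr hg).norm.pow 2)
  rw [← Ioc_union_Ioi_eq_Ioi (zero_le_one : (0 : ℝ) ≤ 1)]
  refine IntegrableOn.union ?_ ?_
  · refine IntegrableOn.of_bound (by simp)
      ((hcont.mono Ioc_subset_Ioi_self).aestronglyMeasurable measurableSet_Ioc) (C ^ 2) ?_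
    refine (ae_restrict_iff' measurableSet_Ioc).2 (Filter.Eventually.of_forall fun r hr => ?_)
    rw [Real.norm_of_nonneg (by positivity)]
    exact pow_le_pow_left₀ (norm_nonneg _) (hC r hr) 2
  · refine (((integrableOn_sq_norm_expLaurent c₀ c₁ c₂ ha).add
      (integrableOn_sq_norm_expLaurent d₀ d₁ d₂ hb)).const_mul 2).mono'
      ((hcont.mono (Ioi_subset_Ioi zero_le_one)).aestronglyMeasurable measurableSet_Ioi) ?_
    refine (ae_restrict_iff' measurableSet_Ioi).2 (Filter.Eventually.of_forall fun r hr => ?_)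
    rw [Real.norm_of_nonneg (by positivity), hg (mem_Ioi.2 (zero_lt_one.trans hr))]
    refine (pow_le_pow_left₀ (norm_nonneg _) (norm_sub_le _ _) 2).trans ?_
    simpa using add_sq_le

lemma Tl_Tl_eq {l : ℕ} {a b c₀ c₁ c₂ d₀ d₁ d₂ μ : ℂ} (hc : IsEigenCoeff l a c₀ c₁ c₂)
    (hd : IsEigenCoeff l b d₀ d₁ d₂) {g : ℝ → ℂ}
    (hg : EqOn g (fun r => expLaurent c₀ c₁ c₂ 0 a r - expLaurent d₀ d₁ d₂ 0 b r) (Ioi 0))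
    (ha : a ^ 4 = μ) (hb : b ^ 4 = μ) {r : ℝ} (hr : r ∈ Ioi (0 : ℝ)) :
    Tl l (Tl l g) r = μ * g r := by
  have hg' : EqOn g (fun r => 1 * expLaurent c₀ c₁ c₂ 0 a r
      + (-1) * expLaurent d₀ d₁ d₂ 0 b r) (Ioi 0) := fun s hs => by rw [hg hs]; ring
  rw [Tl_eqOn hc hd (Tl_eqOn hc hd hg') hr, hg hr]
  linear_combination expLaurent c₀ c₁ c₂ 0 a r * ha - expLaurent d₀ d₁ d₂ 0 b r * hb

lemma exp_I_mul_mul_re_neg {θ ρ : ℝ} (h₁ : Real.pi / 2 < θ) (h₂ : θ < Real.pi + Real.pi / 2)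
    (hρ : 0 < ρ) : (Complex.exp (Complex.I * θ) * ρ).re < 0 := by
  rw [Complex.re_mul_ofReal, mul_comm Complex.I, Complex.exp_ofReal_mul_I_re]
  exact mul_neg_of_neg_of_pos (Real.cos_neg_of_pi_div_two_lt_of_lt h₁ h₂) hρ

lemma exp_I_mul_mul_pow_four {θ : ℂ} (n : ℕ) (hθ : 4 * θ = Real.pi / 2 + n * (2 * Real.pi))
    (ρ : ℂ) : (Complex.exp (Complex.I * θ) * ρ) ^ 4 = Complex.I * ρ ^ 4 := by
  rw [mul_pow, ← Complex.exp_nat_mul]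
  congr 1
  have : ((4 : ℕ) : ℂ) * (Complex.I * θ)
      = Real.pi / 2 * Complex.I + n * (2 * Real.pi * Complex.I) := by
    push_cast
    linear_combination Complex.I * hθ
  rw [this, Complex.exp_add, Complex.exp_nat_mul_two_pi_mul_I, mul_one,
    Complex.exp_pi_div_two_mul_I]

/-- For `l ∈ {1,2}` and `ρ > 0`, the function `g_{l+}` is square integrable on
`(0,∞)` and satisfies `T_l² g_{l+} = i ρ⁴ g_{l+}` there. -/
theorem stmt5 (l : ℕ) (hl : l = 1 ∨ l = 2) (ρ : ℝ) (hρ : 0 < ρ) :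
    IntegrableOn (fun r => ‖gPlus l ρ r‖ ^ 2) (Ioi 0) ∧
    ∀ r ∈ Ioi (0 : ℝ),
      Tl l (Tl l (gPlus l ρ)) r = Complex.I * (ρ : ℂ) ^ 4 * gPlus l ρ r := by
  have hπ := Real.pi_pos
  set a : ℂ := Complex.exp (Complex.I * (5 * Real.pi / 8)) * ρ with ha
  set b : ℂ := Complex.exp (Complex.I * (9 * Real.pi / 8)) * ρ with hb
  have ha4 : a ^ 4 = Complex.I * (ρ : ℂ) ^ 4 :=
    exp_I_mul_mul_pow_four 1 (by push_cast; ring) _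
  have hb4 : b ^ 4 = Complex.I * (ρ : ℂ) ^ 4 :=
    exp_I_mul_mul_pow_four 2 (by push_cast; ring) _
  have hare : a.re < 0 := by
    have := exp_I_mul_mul_re_neg (θ := 5 * Real.pi / 8) (by linarith) (by linarith) hρ
    push_cast at this
    exact this
  have hbre : b.re < 0 := by
    have := exp_I_mul_mul_re_neg (θ := 9 * Real.pi / 8) (by linarith) (by linarith) hρ
    push_cast at this
    exact this
  rcases hl with rfl | rfl
  · have hg : EqOn (gPlus 1 ρ) _ (Ioi 0) := Dop_one_eqOn a b
    refine ⟨integrableOn_sq_norm_sub (C := 2 * ‖a‖ * Real.exp ‖a‖ + 2 * ‖b‖ * Real.exp ‖b‖)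
      hg hare hbre fun r hr => ?_, fun r hr =>
      Tl_Tl_eq ?_ ?_ hg ha4 hb4 hr⟩
    · rw [hg hr.1, ← add_sub_add_right_eq_sub _ _ (1 / (r : ℂ))]
      exact (norm_sub_le _ _).trans
        (add_le_add (norm_expLaurent_one_add_le a hr) (norm_expLaurent_one_add_le b hr))
    all_goals
      refine ⟨?_, ?_, ?_⟩ <;> push_cast <;> ring
  · have hg : EqOn (gPlus 2 ρ) _ (Ioi 0) := Dop_two_eqOn a b
    refine ⟨integrableOn_sq_norm_sub (C := 7 * ‖a‖ ^ 2 * Real.exp ‖a‖ + 7 * ‖b‖ ^ 2 * Real.exp ‖b‖)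
      hg hare hbre fun r hr => ?_, fun r hr =>
      Tl_Tl_eq ?_ ?_ hg ha4 hb4 hr⟩
    · rw [hg hr.1, ← sub_sub_sub_cancel_right _ _ (3 / (r : ℂ) ^ 2)]
      exact (norm_sub_le _ _).trans
        (add_le_add (norm_expLaurent_two_sub_le a hr) (norm_expLaurent_two_sub_le b hr))
    all_goals
      refine ⟨?_, ?_, ?_⟩ <;> push_cast <;> ring
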